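/- Let f : ℝ^d → ℝ be twice continuously differentiable and suppose there exist λ > 0 and Λ > 0 such that, for all π, v ∈ ℝ^d, ⟨v, (Hf)(π) v⟩ ≤ −λ‖v‖² and ‖(Hf)(π) v‖ ≤ Λ‖v‖, where Hf denotes the Hessian of f. Let M be a real n × d matrix, g, h ∈ ℝ^n, and p, q ∈ ℝ^d with Mᵀg + ∇f(p) = 0 and Mᵀh + ∇f(q) = 0. Then the residual R := ⟨Mᵀh, q − p⟩ + f(q) − f(p) satisfies (λ/2)‖q − p‖² ≤ R ≤ (Λ/(2λ²)) ‖Mᵀ(h − g)‖². -/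

import Mathlib

open scoped RealInnerProductSpace
open Matrix

/-- The Hessian of `f` at `x`, as the derivative of the gradient. -/
noncomputable def hess {d : ℕ} (f : EuclideanSpace ℝ (Fin d) → ℝ)
    (x : EuclideanSpace ℝ (Fin d)) :
    EuclideanSpace ℝ (Fin d) →L[ℝ] EuclideanSpace ℝ (Fin d) :=
  fderiv ℝ (gradient f) x

/-- View a plain vector as an element of Euclidean space. -/
noncomputable def toEuc {m : ℕ} (v : Fin m → ℝ) : EuclideanSpace ℝ (Fin m) :=
  (WithLp.equiv 2 (Fin m → ℝ)).symm v

/-- View an element of Euclidean space as a plain vector. -/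
noncomputable def fromEuc {m : ℕ} (v : EuclideanSpace ℝ (Fin m)) : Fin m → ℝ :=
  WithLp.equiv 2 (Fin m → ℝ) v

theorem add_half_le_of_le_second_deriv {φ φ' φ'' : ℝ → ℝ} {c : ℝ}
    (h₁ : ∀ t, HasDerivAt φ (φ' t) t) (h₂ : ∀ t, HasDerivAt φ' (φ'' t) t)
    (hc : ∀ t, c ≤ φ'' t) : φ 0 + φ' 0 + c / 2 ≤ φ 1 := by
  have hlin : ∀ t, 0 ≤ t → c * t ≤ φ' t - φ' 0 := fun t ht => by
    simpa using mul_sub_le_image_sub_of_le_deriv (fun s => (h₂ s).differentiableAt)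
      (fun s => (hc s).trans_eq (h₂ s).deriv.symm) ht
  have hχ : ∀ t, HasDerivAt (fun s => φ s - φ' 0 * s - c / 2 * s ^ 2)
      (φ' t - φ' 0 - c * t) t := fun t => by
    have := ((h₁ t).sub ((hasDerivAt_id t).const_mul (φ' 0))).sub
      (((hasDerivAt_id t).pow 2).const_mul (c / 2))
    exact this.congr_deriv (by norm_num; ring)
  have hmono : MonotoneOn (fun s => φ s - φ' 0 * s - c / 2 * s ^ 2) (Set.Ici 0) := by
    refine monotoneOn_of_deriv_nonneg (convex_Ici 0)
      (fun t _ => (hχ t).continuousAt.continuousWithinAt)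
      (fun t _ => (hχ t).differentiableAt.differentiableWithinAt) fun t ht => ?_
    rw [(hχ t).deriv]
    linarith [hlin t (interior_subset ht)]
  have := hmono (Set.mem_Ici.2 le_rfl) (Set.mem_Ici.2 zero_le_one) zero_le_one
  simp only [mul_zero, mul_one] at this
  linarith

section Gradient

variable {E : Type*} [NormedAddCommGroup E] [InnerProductSpace ℝ E] [CompleteSpace E]

theorem ContDiff.differentiable_gradient {f : E → ℝ} (hf : ContDiff ℝ 2 f) :
    Differentiable ℝ (gradient f) :=
  (InnerProductSpace.toDual ℝ E).symm.toContinuousLinearEquiv.differentiable.comp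
    ((hf.fderiv_right (m := 1) (by norm_num)).differentiable (by norm_num))

theorem hasDerivAt_comp_line {f : E → ℝ} (hf : Differentiable ℝ f) (x v : E) (t : ℝ) :
    HasDerivAt (fun s : ℝ => f (x + s • v)) ⟪gradient f (x + t • v), v⟫ t := by
  have hl : HasDerivAt (fun s : ℝ => x + s • v) v t := by
    simpa using ((hasDerivAt_id t).smul_const v).const_add x
  exact (hf (x + t • v)).hasGradientAt.hasFDerivAt.comp_hasDerivAt t hl

theorem hasDerivAt_inner_gradient_line {f : E → ℝ} (hf : ContDiff ℝ 2 f) (x v : E) (t : ℝ) :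
    HasDerivAt (fun s : ℝ => ⟪gradient f (x + s • v), v⟫)
      ⟪v, fderiv ℝ (gradient f) (x + t • v) v⟫ t := by
  have hl : HasDerivAt (fun s : ℝ => x + s • v) v t := by
    simpa using ((hasDerivAt_id t).smul_const v).const_add x
  have := ((hf.differentiable_gradient (x + t • v)).hasFDerivAt.comp_hasDerivAt t hl).inner ℝ
    (hasDerivAt_const t v)
  simpa [real_inner_comm] using this

theorem half_le_sub_of_le_hessian {f : E → ℝ} (hf : ContDiff ℝ 2 f) {c : ℝ} (x y : E)
    (hc : ∀ z, c ≤ ⟪y - x, fderiv ℝ (gradient f) z (y - x)⟫) :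
    f x + ⟪gradient f x, y - x⟫ + c / 2 ≤ f y := by
  simpa using add_half_le_of_le_second_deriv
    (hasDerivAt_comp_line (hf.differentiable (by norm_num)) x (y - x))
    (hasDerivAt_inner_gradient_line hf x (y - x)) (fun t => hc _)

theorem sub_le_half_of_hessian_le {f : E → ℝ} (hf : ContDiff ℝ 2 f) {c : ℝ} (x y : E)
    (hc : ∀ z, ⟪y - x, fderiv ℝ (gradient f) z (y - x)⟫ ≤ c) :
    f y ≤ f x + ⟪gradient f x, y - x⟫ + c / 2 := by
  have := add_half_le_of_le_second_deriv (c := -c)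
    (fun t => (hasDerivAt_comp_line (hf.differentiable (by norm_num)) x (y - x) t).neg)
    (fun t => (hasDerivAt_inner_gradient_line hf x (y - x) t).neg) (fun t => neg_le_neg (hc _))
  simp only [Pi.neg_apply, zero_smul, one_smul, add_zero, add_sub_cancel] at this
  linarith

theorem inner_gradient_sub_le_of_hessian_le {f : E → ℝ} (hf : ContDiff ℝ 2 f) {c : ℝ} (x y : E)
    (hc : ∀ z, ⟪y - x, fderiv ℝ (gradient f) z (y - x)⟫ ≤ c) :
    ⟪gradient f y - gradient f x, y - x⟫ ≤ c := by
  have hd := hasDerivAt_inner_gradient_line hf x (y - x)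
  simpa [inner_sub_left] using image_sub_le_mul_sub_of_deriv_le
    (fun t => (hd t).differentiableAt) (fun t => (hd t).deriv.trans_le (hc _)) zero_le_one

end Gradient

theorem stmt_9 {d n : ℕ} (f : EuclideanSpace ℝ (Fin d) → ℝ)
    (hf : ContDiff ℝ 2 f) (lam Lam : ℝ) (hlam : 0 < lam) (hLam : 0 < Lam)
    (hconc : ∀ π v : EuclideanSpace ℝ (Fin d), ⟪v, hess f π v⟫ ≤ -lam * ‖v‖ ^ 2)
    (hbdd : ∀ π v : EuclideanSpace ℝ (Fin d), ‖hess f π v‖ ≤ Lam * ‖v‖)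
    (M : Matrix (Fin n) (Fin d) ℝ) (g h : EuclideanSpace ℝ (Fin n))
    (p q : EuclideanSpace ℝ (Fin d))
    (hp : toEuc (Mᵀ.mulVec (fromEuc g)) + gradient f p = 0)
    (hq : toEuc (Mᵀ.mulVec (fromEuc h)) + gradient f q = 0) :
    lam / 2 * ‖q - p‖ ^ 2 ≤ ⟪toEuc (Mᵀ.mulVec (fromEuc h)), q - p⟫ + f q - f p ∧
      ⟪toEuc (Mᵀ.mulVec (fromEuc h)), q - p⟫ + f q - f p ≤
        Lam / (2 * lam ^ 2) * ‖toEuc (Mᵀ.mulVec (fromEuc (h - g)))‖ ^ 2 := by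
  have hup : ∀ z, ⟪p - q, fderiv ℝ (gradient f) z (p - q)⟫ ≤ -lam * ‖q - p‖ ^ 2 := fun z => by
    simpa only [norm_sub_rev q p, hess] using hconc z (p - q)
  have hlow : ∀ z, -(Lam * ‖q - p‖ ^ 2) ≤ ⟪p - q, fderiv ℝ (gradient f) z (p - q)⟫ := fun z => by
    have h₁ := (abs_le.1 (abs_real_inner_le_norm (p - q) (hess f z (p - q)))).1
    have h₂ := mul_le_mul_of_nonneg_left (hbdd z (p - q)) (norm_nonneg (p - q))
    rw [norm_sub_rev q p]
    change _ ≤ ⟪p - q, hess f z (p - q)⟫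
    linarith
  have hR := half_le_sub_of_le_hessian hf q p hlow
  have hR' := sub_le_half_of_hessian_le hf q p hup
  have hmono := inner_gradient_sub_le_of_hessian_le hf q p hup
  have hdiff : toEuc (Mᵀ.mulVec (fromEuc (h - g))) = gradient f p - gradient f q := by
    have hsub : toEuc (Mᵀ.mulVec (fromEuc (h - g))) =
        toEuc (Mᵀ.mulVec (fromEuc h)) - toEuc (Mᵀ.mulVec (fromEuc g)) := by
      simp [toEuc, fromEuc, Matrix.mulVec_sub]
    rw [hsub, eq_neg_of_add_eq_zero_left hp, eq_neg_of_add_eq_zero_left hq]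
    abel
  have hinner : ⟪toEuc (Mᵀ.mulVec (fromEuc h)), q - p⟫ = ⟪gradient f q, p - q⟫ := by
    rw [eq_neg_of_add_eq_zero_left hq, ← neg_sub p q, inner_neg_neg]
  rw [hinner, hdiff]
  refine ⟨by linarith, ?_⟩
  have hnorm : lam * ‖q - p‖ ≤ ‖gradient f p - gradient f q‖ := by
    have hcs := (abs_le.1 (abs_real_inner_le_norm (gradient f p - gradient f q) (p - q))).1
    rw [norm_sub_rev p q] at hcs
    rcases (norm_nonneg (q - p)).eq_or_lt with h₀ | h₀
    · simp [← h₀]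
    · exact le_of_mul_le_mul_right (by linarith) h₀
  have hsq : (lam * ‖q - p‖) ^ 2 ≤ ‖gradient f p - gradient f q‖ ^ 2 := by gcongr
  calc ⟪gradient f q, p - q⟫ + f q - f p ≤ Lam / (2 * lam ^ 2) * (lam * ‖q - p‖) ^ 2 := by
        have : Lam / (2 * lam ^ 2) * (lam * ‖q - p‖) ^ 2 = Lam * ‖q - p‖ ^ 2 / 2 := by
          field_simp
        linarith
    _ ≤ _ := by gcongr
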